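/- arXiv:nlin/0312003 — 14 statements merged into one kernel-verified Lean document; each statement's English description precedes it below -/
import Mathlib

section
/- Let A be a set and let • be a binary operation on A. If ∘ and * are binary operations on A such that both (A, •, ∘) and (A, •, *) are semicentral bigroupoids, then ∘ and * are equal as operations (not merely isomorphic): a ∘ b = a * b for all a, b ∈ A. -/
/-- `IsSCB mul cir` says that `(A, mul, cir)` is a semicentral bigroupoid:
`(a ∘ b) • (b ∘ c) = b` and `(a • b) ∘ (b • a) = b` for all `a b c`. -/
def IsSCB {A : Type*} (mul cir : A → A → A) : Prop :=
  (∀ a b c : A, mul (cir a b) (cir b c) = b) ∧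
  (∀ a b : A, cir (mul a b) (mul b a) = b)

/-- if `(A, •, ∘)` and `(A, •, *)` are both semicentral bigroupoids,
then `∘` and `*` coincide. -/
theorem second_operation_unique {A : Type*} (mul cir cir' : A → A → A)
    (h : IsSCB mul cir) (h' : IsSCB mul cir') :
    ∀ a b : A, cir a b = cir' a b := by
  intro a b
  have key := h.2 (cir' b a) (cir' a b)
  rwa [h'.1 b a b, h'.1 a b a] at key
end

section
/- Every semicentral bigroupoid is rectangular: if (A, •, ∘) is a semicentral bigroupoid and a, b, c, d ∈ A satisfy a • b = c • d, then a • d = a • b and c • b = a • b. -/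
/-- In a semicentral bigroupoid, right multiplying `a` by any `(a • b) ∘ z` gives `a • b`. -/
theorem IsSCB.mul_cir_mul {A : Type*} {mul cir : A → A → A} (h : IsSCB mul cir) (a b z : A) :
    mul a (cir (mul a b) z) = mul a b := by
  have key := h.1 (mul b a) (mul a b) z
  rwa [h.2 b a] at key

/-- In a semicentral bigroupoid, `a • b = c • d` implies `a • d = a • b`. -/
theorem IsSCB.mul_eq_of_mul_eq_mul {A : Type*} {mul cir : A → A → A} (h : IsSCB mul cir)
    {a b c d : A} (heq : mul a b = mul c d) : mul a d = mul a b := by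
  have key := h.mul_cir_mul a b (mul d c)
  rwa [heq, h.2 c d, ← heq] at key

/-- every semicentral bigroupoid is rectangular:
`a • b = c • d` implies `a • d = a • b` and `c • b = a • b`. -/
theorem scb_rectangular {A : Type*} (mul cir : A → A → A) (h : IsSCB mul cir) :
    ∀ a b c d : A, mul a b = mul c d → mul a d = mul a b ∧ mul c b = mul a b := by
  intro a b c d heq
  exact ⟨h.mul_eq_of_mul_eq_mul heq, (h.mul_eq_of_mul_eq_mul heq.symm).trans heq.symm⟩
end

section
/- Let (A, •, ∘) be a semicentral bigroupoid on a finite set A and define the square map ρ : A → A by ρ(a) = a • a. Then ρ is a bijection of A, and there exist binary operations * and ⋄ on A such that (A, *, ⋄) is an idempotent semicentral bigroupoid and a • b = ρ(a * b) for all a, b ∈ A. That is, every finite semicentral bigroupoid is the lifting of an idempotent one by its square map. -/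
/-- for a finite semicentral bigroupoid `(A, •, ∘)`, the square map
`ρ a = a • a` is a bijection and there is an idempotent semicentral bigroupoid
structure `(A, *, ⋄)` with `a • b = ρ (a * b)`. -/
theorem scb_lifting_of_idempotent {A : Type*} [Finite A]
    (mul cir : A → A → A) (h : IsSCB mul cir)
    (ρ : A → A) (hρ : ∀ a, ρ a = mul a a) :
    Function.Bijective ρ ∧
    ∃ star diamond : A → A → A,
      IsSCB star diamond ∧ (∀ a : A, star a a = a) ∧
      (∀ a b : A, mul a b = ρ (star a b)) := by
  have cir_ρ : ∀ a, cir (ρ a) (ρ a) = a := fun a => by rw [hρ]; exact h.2 a a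
  have ρ_cir : ∀ a, ρ (cir a a) = a := fun a => by rw [hρ]; exact h.1 a a a
  refine ⟨Function.bijective_iff_has_inverse.2 ⟨fun a => cir a a, cir_ρ, ρ_cir⟩,
    fun a b => cir (mul a b) (mul a b), fun a b => cir (ρ a) (ρ b),
    ⟨fun a b c => ?_, fun a b => ?_⟩, fun a => h.2 a a, fun a b => (ρ_cir _).symm⟩
  · simp only [h.1, cir_ρ]
  · simp only [ρ_cir, h.2]
end

section
/- Let (A, *, ⋄) be an idempotent semicentral bigroupoid and let ρ : A → A be a bijection. Define a • b = ρ(a * b). Then there exists a binary operation ∘ on A such that (A, •, ∘) is a semicentral bigroupoid (the lifting of (A, *, ⋄) by ρ), and the square map of • is ρ, i.e. a • a = ρ(a) for all a ∈ A. -/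
/-- lifting an idempotent semicentral bigroupoid `(A, *, ⋄)` by a
bijection `ρ` via `a • b = ρ (a * b)` yields a semicentral bigroupoid whose
square map is `ρ`. -/
theorem lifting_is_scb {A : Type*} (star diamond : A → A → A)
    (h : IsSCB star diamond) (hidem : ∀ a : A, star a a = a)
    (ρ : A → A) (hρ : Function.Bijective ρ)
    (mul : A → A → A) (hmul : ∀ a b : A, mul a b = ρ (star a b)) :
    (∃ cir : A → A → A, IsSCB mul cir) ∧ (∀ a : A, mul a a = ρ a) := by
  obtain ⟨σ, hσρ, hρσ⟩ := Function.bijective_iff_has_inverse.mp hρ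
  refine ⟨⟨fun a b => diamond (σ a) (σ b), fun a b c => ?_, fun a b => ?_⟩, fun a => ?_⟩
  · rw [hmul, h.1, hρσ]
  · simp only [hmul, hσρ _, h.2]
  · rw [hmul, hidem]
end

section
/- Let (A, •, ∘) be a semicentral bigroupoid. For every a ∈ A and all l, r ∈ A, one has l • r = a if and only if l ∈ L_a and r ∈ R_a. Consequently, for every pair (s, t) ∈ A × A, the element a = s • t is the unique element of A with s ∈ L_a and t ∈ R_a. -/
/-- `Lset mul a = {x | ∃ y, x • y = a}`. -/
def Lset {A : Type*} (mul : A → A → A) (a : A) : Set A := {x | ∃ y, mul x y = a}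

/-- `Rset mul a = {y | ∃ x, x • y = a}`. -/
def Rset {A : Type*} (mul : A → A → A) (a : A) : Set A := {y | ∃ x, mul x y = a}

/-- The operation `mul` is rectangular: if `l • y = a` and `x • r = a`, then `l • r = a`. -/
theorem IsSCB.mul_eq_of_mul_eq {A : Type*} {mul cir : A → A → A} (h : IsSCB mul cir)
    {a l r x y : A} (hl : mul l y = a) (hr : mul x r = a) : mul l r = a := by
  have hl' : cir (mul y l) a = l := by simpa only [hl] using h.2 y l
  have hr' : cir a (mul r x) = r := by simpa only [hr] using h.2 x r
  simpa only [hl', hr'] using h.1 (mul y l) a (mul r x)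

/-- in a semicentral bigroupoid, `l • r = a ↔ l ∈ L_a ∧ r ∈ R_a`,
and for every pair `(s, t)` the element `s • t` is the unique `a` with
`s ∈ L_a` and `t ∈ R_a`. -/
theorem scb_L_R_characterization {A : Type*} (mul cir : A → A → A)
    (h : IsSCB mul cir) :
    (∀ a l r : A, mul l r = a ↔ l ∈ Lset mul a ∧ r ∈ Rset mul a) ∧
    (∀ s t : A, ∃! a : A, s ∈ Lset mul a ∧ t ∈ Rset mul a) ∧
    (∀ s t : A, s ∈ Lset mul (mul s t) ∧ t ∈ Rset mul (mul s t)) := by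
  have rect : ∀ a l r : A, mul l r = a ↔ l ∈ Lset mul a ∧ r ∈ Rset mul a :=
    fun a l r => ⟨fun e => ⟨⟨r, e⟩, ⟨l, e⟩⟩, fun ⟨⟨_, hl⟩, ⟨_, hr⟩⟩ => h.mul_eq_of_mul_eq hl hr⟩
  have mem : ∀ s t : A, s ∈ Lset mul (mul s t) ∧ t ∈ Rset mul (mul s t) :=
    fun s t => (rect _ s t).1 rfl
  exact ⟨rect, fun s t => ⟨mul s t, mem s t, fun b hb => ((rect b s t).2 hb).symm⟩, mem⟩
end

section
/- Let (A, •, ∘) be a semicentral bigroupoid on a finite set A. Then for all a, b ∈ A one has |L_a| = |L_b| and |R_a| = |R_b|, and moreover |L_a| · |R_a| = |A| for every a ∈ A. (The common pair (|L_a|, |R_a|) is called the format of the semicentral bigroupoid.) -/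
namespace IsSCB

variable {A : Type*} {mul cir : A → A → A}

theorem cir_mem_Lset (h : IsSCB mul cir) (a b : A) : cir a b ∈ Lset mul b :=
  ⟨cir b b, h.1 a b b⟩

theorem cir_mem_Rset (h : IsSCB mul cir) (a b : A) : cir a b ∈ Rset mul a :=
  ⟨cir a a, h.1 a a b⟩

theorem mul_eq (h : IsSCB mul cir) {x y b : A} (hx : x ∈ Lset mul b) (hy : y ∈ Rset mul b) :
    mul x y = b := by
  obtain ⟨u, rfl⟩ := hx
  obtain ⟨v, hv⟩ := hy
  have e := h.1 (mul u x) (mul x u) (mul y v)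
  rwa [h.2 u x, ← hv, h.2 v y, hv] at e

theorem cir_eq (h : IsSCB mul cir) {x a b : A} (ha : x ∈ Rset mul a) (hb : x ∈ Lset mul b) :
    cir a b = x := by
  have e := h.2 (cir b a) x
  rwa [h.mul_eq (h.cir_mem_Lset b a) ha, h.mul_eq hb (h.cir_mem_Rset b a)] at e

/-- `a • (a • y ∘ b) = a • y`. -/
theorem mul_cir_mul_left (h : IsSCB mul cir) (a y b : A) :
    mul a (cir (mul a y) b) = mul a y :=
  h.mul_eq ⟨y, rfl⟩ (h.cir_mem_Rset _ _)

/-- `(b ∘ y • a) • a = y • a`. -/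
theorem mul_cir_mul_right (h : IsSCB mul cir) (a y b : A) :
    mul (cir b (mul y a)) a = mul y a :=
  h.mul_eq (h.cir_mem_Lset _ _) ⟨y, rfl⟩

theorem cir_mul_left (h : IsSCB mul cir) {l a : A} (hl : l ∈ Lset mul a) (z : A) :
    cir (mul z l) a = l :=
  h.cir_eq ⟨z, rfl⟩ hl

theorem cir_mul_right (h : IsSCB mul cir) {r a : A} (hr : r ∈ Rset mul a) (z : A) :
    cir a (mul r z) = r :=
  h.cir_eq hr ⟨z, rfl⟩

/-- Any two left sets are in bijection. -/
def lsetEquiv (h : IsSCB mul cir) (a b : A) : Lset mul a ≃ Lset mul b where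
  toFun x := ⟨cir (mul a x) b, h.cir_mem_Lset _ _⟩
  invFun x := ⟨cir (mul a x) a, h.cir_mem_Lset _ _⟩
  left_inv x := Subtype.ext <| by
    simp only [h.mul_cir_mul_left, h.cir_mul_left x.2]
  right_inv x := Subtype.ext <| by
    simp only [h.mul_cir_mul_left, h.cir_mul_left x.2]

/-- Any two right sets are in bijection. -/
def rsetEquiv (h : IsSCB mul cir) (a b : A) : Rset mul a ≃ Rset mul b where
  toFun x := ⟨cir b (mul x a), h.cir_mem_Rset _ _⟩
  invFun x := ⟨cir a (mul x a), h.cir_mem_Rset _ _⟩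
  left_inv x := Subtype.ext <| by
    simp only [h.mul_cir_mul_right, h.cir_mul_right x.2]
  right_inv x := Subtype.ext <| by
    simp only [h.mul_cir_mul_right, h.cir_mul_right x.2]

/-- The underlying set is in bijection with `L_a × R_a`. -/
def prodEquiv (h : IsSCB mul cir) (a : A) : Lset mul a × Rset mul a ≃ A where
  toFun p := cir (mul a p.1) (mul p.2 a)
  invFun y := (⟨cir (mul a y) a, h.cir_mem_Lset _ _⟩, ⟨cir a (mul y a), h.cir_mem_Rset _ _⟩)
  left_inv p := Prod.ext
    (Subtype.ext <| by simp only [h.mul_cir_mul_left, h.cir_mul_left p.1.2])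
    (Subtype.ext <| by simp only [h.mul_cir_mul_right, h.cir_mul_right p.2.2])
  right_inv y := by
    simp only [h.mul_cir_mul_left, h.mul_cir_mul_right, h.2]

end IsSCB

/-- in a finite semicentral bigroupoid, `|L_a| = |L_b|`,
`|R_a| = |R_b|` for all `a b`, and `|L_a| * |R_a| = |A|` for all `a`
(the common pair `(|L_a|, |R_a|)` is the format). -/
theorem scb_format {A : Type*} [Fintype A] (mul cir : A → A → A)
    (h : IsSCB mul cir) :
    (∀ a b : A, (Lset mul a).ncard = (Lset mul b).ncard) ∧
    (∀ a b : A, (Rset mul a).ncard = (Rset mul b).ncard) ∧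
    (∀ a : A, (Lset mul a).ncard * (Rset mul a).ncard = Fintype.card A) := by
  refine ⟨fun a b => Nat.card_congr (h.lsetEquiv a b),
    fun a b => Nat.card_congr (h.rsetEquiv a b), fun a => ?_⟩
  rw [← Nat.card_coe_set_eq, ← Nat.card_coe_set_eq, ← Nat.card_prod,
    Nat.card_congr (h.prodEquiv a), Nat.card_eq_fintype_card]
end

section
/- Let A be a finite set and let f : A → A → A be a local rule satisfying f(a, a) = a for all a ∈ A. If φ : A → ℝ is a conslaw for f, then φ satisfies the two-cell requirement, φ(a) + φ(b) = φ(f(a,b)) + φ(f(b,a)) for all a, b ∈ A, and the Hattori–Takesue equations: φ(x) − φ(f(o,x)) + φ(f(o,y)) − φ(f(x,y)) = 0 for all o, x, y ∈ A. -/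
/-- `φ` is an additive conservation law for the local rule `f`: for every
cyclic configuration `a : ZMod n → A` (`n ≥ 1`), the sum of `φ` is preserved
by one application of the global map. -/
def IsConslaw {A : Type*} (f : A → A → A) (φ : A → ℝ) : Prop :=
  ∀ (n : ℕ) [NeZero n] (a : ZMod n → A),
    ∑ i, φ (a i) = ∑ i, φ (f (a i) (a (i + 1)))

theorem IsConslaw.two_cell {A : Type*} {f : A → A → A} {φ : A → ℝ} (hφ : IsConslaw f φ)
    (a b : A) : φ a + φ b = φ (f a b) + φ (f b a) := by
  have h : ∑ i : Fin 2, φ (![a, b] i) = ∑ i : Fin 2, φ (f (![a, b] i) (![a, b] (i + 1))) :=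
    hφ 2 ![a, b]
  simpa [Fin.sum_univ_two] using h

theorem IsConslaw.three_cell {A : Type*} {f : A → A → A} {φ : A → ℝ} (hφ : IsConslaw f φ)
    (a b c : A) : φ a + φ b + φ c = φ (f a b) + φ (f b c) + φ (f c a) := by
  have h : ∑ i : Fin 3, φ (![a, b, c] i) =
      ∑ i : Fin 3, φ (f (![a, b, c] i) (![a, b, c] (i + 1))) :=
    hφ 3 ![a, b, c]
  rw [Fin.sum_univ_three, Fin.sum_univ_three] at h
  exact h

/-- any conslaw for an idempotent local rule on a finite set
satisfies the two-cell requirement and the Hattori–Takesue equations. -/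
theorem conslaw_two_cell_and_HT {A : Type*} [Finite A] (f : A → A → A)
    (hidem : ∀ a : A, f a a = a) (φ : A → ℝ) (hφ : IsConslaw f φ) :
    (∀ a b : A, φ a + φ b = φ (f a b) + φ (f b a)) ∧
    (∀ o x y : A, φ x - φ (f o x) + φ (f o y) - φ (f x y) = 0) := by
  refine ⟨hφ.two_cell, fun o x y => ?_⟩
  linarith [hφ.two_cell o y, hφ.three_cell o x y]
end

section
/- Let A be a set, let * be an idempotent binary operation on A (a * a = a for all a), let ρ : A → A be a bijection, and define the lifted local rule f(a, b) = ρ(a * b). If φ : A → ℝ is a conslaw for f, then φ is constant on the orbits of ρ (i.e., φ(ρ(a)) = φ(a) for all a ∈ A) and φ is a conslaw for the local rule (a, b) ↦ a * b. -/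
/-- a conslaw for the lifted rule `f a b = ρ (a * b)` of an
idempotent operation `*` by a bijection `ρ` is constant on `ρ`-orbits and is
a conslaw for `*` itself. -/
theorem conslaw_of_lifting {A : Type*} (star : A → A → A)
    (hidem : ∀ a : A, star a a = a) (ρ : A → A) (hρ : Function.Bijective ρ)
    (f : A → A → A) (hf : ∀ a b : A, f a b = ρ (star a b))
    (φ : A → ℝ) (hφ : IsConslaw f φ) :
    (∀ a : A, φ (ρ a) = φ a) ∧ IsConslaw (fun a b => star a b) φ := by
  have hinv : ∀ a : A, φ (ρ a) = φ a := fun a => by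
    simpa [hf, hidem] using (hφ 1 fun _ => a).symm
  refine ⟨hinv, fun n _ a => ?_⟩
  simpa only [hf, hinv] using hφ n a
end

section
/- Let (A, •, ∘) be an idempotent semicentral bigroupoid on a finite set A with |A| > 2 and with |L_a| = 2 for every a ∈ A (format 2 × n with n ≥ 2). Then A is left or right partitionable: there exists an equivalence relation ≈ on A with more than one equivalence class such that either for every a ∈ A all elements of L_a are ≈-equivalent, or for every a ∈ A all elements of R_a are ≈-equivalent. In particular, such a semicentral bigroupoid is not simple. -/
namespace IsSCB

variable {A : Type*} {mul cir : A → A → A}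

/-- The fibres of the first operation are rectangles. -/
lemma mul_eq_of_mul_eq_s13 (h : IsSCB mul cir) {x y x' y' b : A}
    (hxy : mul x y = b) (hxy' : mul x' y' = b) : mul x y' = b := by
  have hx := h.2 y x
  have hy := h.2 x' y'
  rw [hxy] at hx
  rw [hxy'] at hy
  rw [← hx, ← hy, h.1]

lemma mem_Lset_self (hidem : ∀ a : A, mul a a = a) (a : A) : a ∈ Lset mul a :=
  ⟨a, hidem a⟩

lemma mem_Rset_self (hidem : ∀ a : A, mul a a = a) (a : A) : a ∈ Rset mul a :=
  ⟨a, hidem a⟩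

lemma mul_eq_iff_mem_Rset (h : IsSCB mul cir) {x a y : A} (hx : x ∈ Lset mul a) :
    mul x y = a ↔ y ∈ Rset mul a := by
  obtain ⟨z, hz⟩ := hx
  exact ⟨fun hy => ⟨x, hy⟩, fun ⟨_, hw⟩ => h.mul_eq_of_mul_eq_s13 hz hw⟩

/-- If every `L_a` has two elements, the other element of `L_a` is given by an injective
function of `a`. -/
lemma exists_injective_Lset_eq_pair [Finite A] (h : IsSCB mul cir)
    (hidem : ∀ a : A, mul a a = a) (hformat : ∀ a : A, (Lset mul a).ncard = 2) :
    ∃ f : A → A, Function.Injective f ∧ (∀ a, f a ≠ a) ∧ ∀ a, Lset mul a = {a, f a} := by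
  have hex : ∀ a : A, ∃ b, b ≠ a ∧ Lset mul a = {a, b} := by
    intro a
    obtain ⟨u, v, huv, hL⟩ := Set.ncard_eq_two.mp (hformat a)
    have ha := mem_Lset_self hidem a
    rw [hL] at ha
    rcases ha with rfl | rfl
    · exact ⟨v, huv.symm, hL⟩
    · exact ⟨u, huv, hL.trans (Set.pair_comm _ _)⟩
  choose f hne hL using hex
  refine ⟨f, Finite.injective_iff_surjective.mpr fun x => ?_, hne, hL⟩
  by_contra! hx
  have hxmul : mul x (f x) = x := by
    have hmem : x ∈ Lset mul (mul x (f x)) := ⟨f x, rfl⟩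
    rw [hL] at hmem
    rcases hmem with heq | heq
    · exact heq.symm
    · exact absurd heq.symm (hx _)
  have hfx : f x ∈ Lset mul x := by simp [hL]
  exact hne x ((hidem (f x)).symm.trans ((h.mul_eq_iff_mem_Rset hfx).mpr ⟨x, hxmul⟩))

lemma mem_Rset_iff_notMem (h : IsSCB mul cir) (hidem : ∀ a : A, mul a a = a)
    {f : A → A} (hf : Function.Injective f) (hne : ∀ a, f a ≠ a)
    (hL : ∀ a, Lset mul a = {a, f a}) (a y : A) :
    y ∈ Rset mul a ↔ y ∉ Rset mul (f a) := by
  rw [← h.mul_eq_iff_mem_Rset (mem_Lset_self hidem (f a)),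
    ← h.mul_eq_iff_mem_Rset (show f a ∈ Lset mul a by simp [hL])]
  have hmem : f a ∈ Lset mul (mul (f a) y) := ⟨y, rfl⟩
  rw [hL] at hmem
  rcases hmem with heq | heq
  · simp [← heq, hne]
  · simp [← hf heq, (hne a).symm]

end IsSCB

/-- a finite idempotent semicentral bigroupoid of format `2 × n`
with `|A| > 2` is left or right partitionable: there is an equivalence relation
with more than one class such that each `L_a` (or each `R_a`) lies in a single
class. In particular it is not simple. -/
theorem format_two_partitionable {A : Type*} [Fintype A]
    (mul cir : A → A → A) (h : IsSCB mul cir)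
    (hidem : ∀ a : A, mul a a = a)
    (hcard : 2 < Fintype.card A)
    (hformat : ∀ a : A, (Lset mul a).ncard = 2) :
    ∃ r : A → A → Prop, Equivalence r ∧ (∃ x y : A, ¬ r x y) ∧
      ((∀ a : A, ∀ x ∈ Lset mul a, ∀ y ∈ Lset mul a, r x y) ∨
       (∀ a : A, ∀ x ∈ Rset mul a, ∀ y ∈ Rset mul a, r x y)) := by
  obtain ⟨f, hf, hne, hL⟩ := h.exists_injective_Lset_eq_pair hidem hformat
  have hR := h.mem_Rset_iff_notMem hidem hf hne hL
  let s : A → A → Prop := fun x y =>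
    (∀ z, z ∈ Rset mul x ↔ z ∈ Rset mul y) ∨ (∀ z, z ∈ Rset mul x ↔ z ∉ Rset mul y)
  have hs : Equivalence s := by
    refine ⟨fun x => Or.inl fun z => Iff.rfl, fun {x y} hxy => ?_, fun {x y z} hxy hyz => ?_⟩
    · rcases hxy with hxy | hxy
      · exact Or.inl fun w => (hxy w).symm
      · exact Or.inr fun w => by simp [hxy w]
    · rcases hxy with hxy | hxy <;> rcases hyz with hyz | hyz
      · exact Or.inl fun w => by rw [hxy w, hyz w]
      · exact Or.inr fun w => by rw [hxy w, hyz w]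
      · exact Or.inr fun w => by rw [hxy w, hyz w]
      · exact Or.inl fun w => by rw [hxy w, hyz w, not_not]
  by_cases hall : ∀ x y, s x y
  · obtain ⟨a⟩ : Nonempty A := Fintype.card_pos_iff.mp (by omega)
    refine ⟨fun x y => x ∈ Rset mul a ↔ y ∈ Rset mul a,
      ⟨fun _ => Iff.rfl, Iff.symm, Iff.trans⟩, ⟨a, f a, fun hiff => ?_⟩,
      Or.inr fun b x hx y hy => ?_⟩
    · exact (hR a (f a)).mp (hiff.mp (IsSCB.mem_Rset_self hidem a))
        (IsSCB.mem_Rset_self hidem (f a))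
    · rcases hall a b with hab | hab <;> simp [hab, hx, hy]
  · push Not at hall
    refine ⟨s, hs, hall, Or.inl fun a x hx y hy => ?_⟩
    have hsa : ∀ w ∈ Lset mul a, s a w := by
      intro w hw
      rw [hL] at hw
      rcases hw with rfl | rfl
      · exact hs.refl _
      · exact Or.inr (hR a)
    exact hs.trans (hs.symm (hsa x hx)) (hsa y hy)
end

section
/- Let (A, •, ∘) be an idempotent semicentral bigroupoid on a finite set A with |A| ≥ 2. Then the following are equivalent: (1) A is left or right partitionable, i.e., there exists an equivalence relation ≈ on A with more than one equivalence class such that either for every a ∈ A all elements of L_a are ≈-equivalent, or for every a ∈ A all elements of R_a are ≈-equivalent; (2) there exists a surjective map ψ : A → Bool such that either ψ(x • y) = ψ(x) for all x, y ∈ A, or ψ(x • y) = ψ(y) for all x, y ∈ A (i.e., A maps homomorphically onto a semicentral bigroupoid of order 2). -/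
/-- a finite idempotent semicentral bigroupoid with `|A| ≥ 2` is
left or right partitionable iff it maps homomorphically onto a semicentral
bigroupoid of order 2 (a projection on `Bool`). -/
theorem partitionable_iff_two_element_image {A : Type*} [Fintype A]
    (mul cir : A → A → A) (h : IsSCB mul cir)
    (hidem : ∀ a : A, mul a a = a)
    (hcard : 2 ≤ Fintype.card A) :
    (∃ r : A → A → Prop, Equivalence r ∧ (∃ x y : A, ¬ r x y) ∧
      ((∀ a : A, ∀ x ∈ Lset mul a, ∀ y ∈ Lset mul a, r x y) ∨
       (∀ a : A, ∀ x ∈ Rset mul a, ∀ y ∈ Rset mul a, r x y))) ↔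
    (∃ ψ : A → Bool, Function.Surjective ψ ∧
      ((∀ x y : A, ψ (mul x y) = ψ x) ∨ (∀ x y : A, ψ (mul x y) = ψ y))) := by
  classical
  constructor
  · rintro ⟨r, hr, ⟨u, v, huv⟩, hLR⟩
    refine ⟨fun x => decide (r x u), fun b => ?_, ?_⟩
    · cases b with
      | false => exact ⟨v, decide_eq_false fun hvu => huv (hr.symm hvu)⟩
      | true => exact ⟨u, decide_eq_true (hr.refl u)⟩
    · refine hLR.imp (fun hL x y => ?_) (fun hR x y => ?_)
      · have hxy : r (mul x y) x := hL (mul x y) _ ⟨mul x y, hidem _⟩ _ ⟨y, rfl⟩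
        exact decide_eq_decide.2 ⟨hr.trans (hr.symm hxy), hr.trans hxy⟩
      · have hxy : r (mul x y) y := hR (mul x y) _ ⟨mul x y, hidem _⟩ _ ⟨x, rfl⟩
        exact decide_eq_decide.2 ⟨hr.trans (hr.symm hxy), hr.trans hxy⟩
  · rintro ⟨ψ, hψ, hLR⟩
    obtain ⟨u, hu⟩ := hψ true
    obtain ⟨v, hv⟩ := hψ false
    refine ⟨fun x y => ψ x = ψ y, ⟨fun _ => rfl, Eq.symm, Eq.trans⟩, ⟨u, v, by simp [hu, hv]⟩, ?_⟩
    refine hLR.imp ?_ ?_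
    · rintro hL a x ⟨y, rfl⟩ x' ⟨y', hy'⟩
      rw [← hL x y, ← hy', hL]
    · rintro hR a y ⟨x, rfl⟩ y' ⟨x', hx'⟩
      rw [← hR x y, ← hx', hR]
end

section
/- Let • be a binary operation on a set A and let φ : A → ℝ take only the values 0 and 1 and satisfy the Hattori–Takesue equations and the two-cell requirement for • (as any conslaw does). If a, b ∈ A satisfy φ(a) = 0, φ(b) = 1 and φ(a • b) = 0, then for every c ∈ A one has φ(a • c) = 0 and φ(b • c) = 1. -/
/-- let `φ : A → ℝ` take only the values 0 and 1 and satisfy the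
Hattori–Takesue equations and the two-cell requirement for `•`. If `φ a = 0`,
`φ b = 1` and `φ (a • b) = 0`, then `φ (a • c) = 0` and `φ (b • c) = 1` for
all `c`. -/
theorem zero_one_conslaw_left {A : Type*} (mul : A → A → A) (φ : A → ℝ)
    (hval : ∀ a : A, φ a = 0 ∨ φ a = 1)
    (hHT : ∀ o x y : A, φ x - φ (mul o x) + φ (mul o y) - φ (mul x y) = 0)
    (htwo : ∀ a b : A, φ a + φ b = φ (mul a b) + φ (mul b a))
    (a b : A) (ha : φ a = 0) (hb : φ b = 1) (hab : φ (mul a b) = 0) :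
    ∀ c : A, φ (mul a c) = 0 ∧ φ (mul b c) = 1 := by
  intro c
  have h := hHT a b c
  rcases hval (mul a c) with hac | hac <;> rcases hval (mul b c) with hbc | hbc
  · linarith
  · exact ⟨hac, hbc⟩
  · linarith
  · linarith
end

section
/- Let • be a binary operation on a set A and let φ : A → ℝ take only the values 0 and 1 and satisfy the Hattori–Takesue equations and the two-cell requirement for • (as any conslaw does). If a, b ∈ A satisfy φ(a) = 0, φ(b) = 1 and φ(a • b) = 1, then for every c ∈ A one has φ(c • a) = 0 and φ(c • b) = 1. -/
/-- let `φ : A → ℝ` take only the values 0 and 1 and satisfy the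
Hattori–Takesue equations and the two-cell requirement for `•`. If `φ a = 0`,
`φ b = 1` and `φ (a • b) = 1`, then `φ (c • a) = 0` and `φ (c • b) = 1` for
all `c`. -/
theorem zero_one_conslaw_right {A : Type*} (mul : A → A → A) (φ : A → ℝ)
    (hval : ∀ a : A, φ a = 0 ∨ φ a = 1)
    (hHT : ∀ o x y : A, φ x - φ (mul o x) + φ (mul o y) - φ (mul x y) = 0)
    (htwo : ∀ a b : A, φ a + φ b = φ (mul a b) + φ (mul b a))
    (a b : A) (ha : φ a = 0) (hb : φ b = 1) (hab : φ (mul a b) = 1) :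
    ∀ c : A, φ (mul c a) = 0 ∧ φ (mul c b) = 1 := by
  intro c
  have h := hHT c a b
  rcases hval (mul c a) with h₁ | h₁ <;> rcases hval (mul c b) with h₂ | h₂ <;>
    constructor <;> linarith
end

section
/- Let • be a binary operation on a set A and let φ : A → ℝ take only the values 0 and 1 and satisfy the Hattori–Takesue equations and the two-cell requirement for • (as any conslaw does). If φ is not constant (there exist a, b ∈ A with φ(a) = 0 and φ(b) = 1), then either φ(x • y) = φ(x) for all x, y ∈ A, or φ(x • y) = φ(y) for all x, y ∈ A. In other words, every non-constant {0,1}-valued conslaw is a homomorphism of (A, •) onto a semicentral bigroupoid of order 2. -/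
/-- a non-constant `{0,1}`-valued map `φ : A → ℝ` satisfying the
Hattori–Takesue equations and the two-cell requirement for `•` is a morphism
onto a two-element semicentral bigroupoid: either `φ (x • y) = φ x` for all
`x y`, or `φ (x • y) = φ y` for all `x y`. -/
theorem zero_one_conslaw_is_morphism {A : Type*} (mul : A → A → A) (φ : A → ℝ)
    (hval : ∀ a : A, φ a = 0 ∨ φ a = 1)
    (hHT : ∀ o x y : A, φ x - φ (mul o x) + φ (mul o y) - φ (mul x y) = 0)
    (htwo : ∀ a b : A, φ a + φ b = φ (mul a b) + φ (mul b a))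
    (a b : A) (ha : φ a = 0) (hb : φ b = 1) :
    (∀ x y : A, φ (mul x y) = φ x) ∨ (∀ x y : A, φ (mul x y) = φ y) := by
  by_contra! ⟨⟨x, y, hxy⟩, z, w, hzw⟩
  have hx := hHT a x y
  have hz := hHT a z w
  have hzx := hHT a z x
  have hzy := hHT a z y
  have hwx := hHT a w x
  have hwy := hHT a w y
  have hg : φ (mul a x) ≠ φ (mul a y) := fun h => hxy (by linarith)
  have hh : φ z - φ (mul a z) ≠ φ w - φ (mul a w) := fun h => hzw (by linarith)
  rcases hval (mul z x) with h₁ | h₁ <;> rcases hval (mul z y) with h₂ | h₂ <;>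
    rcases hval (mul w x) with h₃ | h₃ <;> rcases hval (mul w y) with h₄ | h₄ <;>
    first
    | exact hg (by linarith)
    | exact hh (by linarith)
end

section
/- Let (A, •, ∘) be an idempotent semicentral bigroupoid with exactly two elements. Then • is either the left projection or the right projection: either a • b = a for all a, b ∈ A, or a • b = b for all a, b ∈ A. That is, the only idempotent semicentral bigroupoids of order 2 are the left constant and right constant ones. -/
/-- an idempotent semicentral bigroupoid with exactly two
elements is either the left projection or the right projection. -/
theorem two_element_idempotent_scb {A : Type*} [Fintype A]
    (mul cir : A → A → A) (h : IsSCB mul cir)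
    (hidem : ∀ a : A, mul a a = a)
    (hcard : Fintype.card A = 2) :
    (∀ a b : A, mul a b = a) ∨ (∀ a b : A, mul a b = b) := by
  classical
  obtain ⟨x, y, hxy, huniv⟩ := Finset.card_eq_two.mp (Finset.card_univ.trans hcard)
  have hmem : ∀ a : A, a = x ∨ a = y := fun a => by
    simpa [huniv] using Finset.mem_univ a
  have hne : mul x y ≠ mul y x := fun he => by
    have hy := h.2 x y
    have hx := h.2 y x
    rw [he] at hx hy
    exact hxy (hx.symm.trans hy)
  have hx := hidem x
  have hy := hidem y
  rcases hmem (mul x y) with hl | hl <;> rcases hmem (mul y x) with hr | hr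
  · exact absurd (hl.trans hr.symm) hne
  · left
    intro a b
    rcases hmem a with rfl | rfl <;> rcases hmem b with rfl | rfl <;> assumption
  · right
    intro a b
    rcases hmem a with rfl | rfl <;> rcases hmem b with rfl | rfl <;> assumption
  · exact absurd (hl.trans hr.symm) hne
end
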